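/- Let f, g and h be entire functions given by everywhere absolutely convergent vector valued Dirichlet series, and let p ≥ 0, q ≥ 0, m ≥ 0 be integers. Assume 0 < λ_h^{(m,q)}(f) ≤ ρ_h^{(m,q)}(f) < +∞, 0 < λ_h^{(m,p)}(g) ≤ ρ_h^{(m,p)}(g) < +∞, and that the indicators Δ_h^{(m,q)}(f), Δ̄_h^{(m,q)}(f), Δ_h^{(m,p)}(g), Δ̄_h^{(m,p)}(g), τ_h^{(m,p)}(g), τ̄_h^{(m,p)}(g) are all positive and finite. Then τ̄_g^{(p,q)}(f) ≥ max{ (Δ̄_h^{(m,q)}(f)/Δ̄_h^{(m,p)}(g))^{1/ρ_h^{(m,p)}(g)}, (Δ_h^{(m,q)}(f)/Δ_h^{(m,p)}(g))^{1/ρ_h^{(m,p)}(g)}, (Δ_h^{(m,q)}(f)/τ̄_h^{(m,p)}(g))^{1/λ_h^{(m,p)}(g)}, (Δ̄_h^{(m,q)}(f)/τ_h^{(m,p)}(g))^{1/λ_h^{(m,p)}(g)} }. -/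

import Mathlib

open Filter Topology

noncomputable section

/-- An entire function given by an everywhere absolutely convergent
vector valued Dirichlet series, with coefficients in a Banach space `E`. -/
structure VVDS (E : Type*) [NormedAddCommGroup E] [NormedSpace ℂ E] [CompleteSpace E] where
  a : ℕ → E
  lam : ℕ → ℝ
  lam_pos : ∀ n, 0 < lam n
  lam_strictMono : StrictMono lam
  lam_tendsto : Tendsto lam atTop atTop
  log_index_bound : ∃ D : ℝ, ∀ᶠ n : ℕ in atTop, Real.log (n : ℝ) / lam n ≤ D
  coeff_decay : Tendsto (fun n => Real.log ‖a n‖ / lam n) atTop atBot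
  abs_conv : ∀ s : ℂ, Summable (fun n => Real.exp (s.re * lam n) * ‖a n‖)

variable {E F G : Type*} [NormedAddCommGroup E] [NormedSpace ℂ E] [CompleteSpace E]
  [NormedAddCommGroup F] [NormedSpace ℂ F] [CompleteSpace F]
  [NormedAddCommGroup G] [NormedSpace ℂ G] [CompleteSpace G]

/-- The entire function defined by the vector valued Dirichlet series. -/
def VVDS.toFun (f : VVDS E) (s : ℂ) : E := ∑' n, Complex.exp (s * (f.lam n : ℂ)) • f.a n

/-- The maximum modulus function `M_f(σ) = sup_t ‖f(σ+it)‖`. -/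
def VVDS.M (f : VVDS E) (σ : ℝ) : ℝ := ⨆ t : ℝ, ‖f.toFun ((σ : ℂ) + (t : ℂ) * Complex.I)‖

/-- The inverse function of the maximum modulus function. -/
def VVDS.Minv (f : VVDS E) (y : ℝ) : ℝ := sInf {σ : ℝ | y ≤ f.M σ}

/-- The (p,q)-th relative Ritt order of `f` with respect to `g`. -/
def relRittOrder (p q : ℕ) (f : VVDS E) (g : VVDS F) : EReal :=
  limsup (fun σ : ℝ =>
    ((Real.log^[p] (g.Minv (f.M σ)) / Real.log^[q] σ : ℝ) : EReal)) atTop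

/-- The (p,q)-th relative Ritt lower order of `f` with respect to `g`. -/
def relRittLowerOrder (p q : ℕ) (f : VVDS E) (g : VVDS F) : EReal :=
  liminf (fun σ : ℝ =>
    ((Real.log^[p] (g.Minv (f.M σ)) / Real.log^[q] σ : ℝ) : EReal)) atTop

/-- The (p,q)-th relative Ritt type of `f` with respect to `g`. -/
def relRittType (p q : ℕ) (f : VVDS E) (g : VVDS F) : EReal :=
  limsup (fun σ : ℝ =>
    ((Real.log^[p-1] (g.Minv (f.M σ)) /
      (Real.log^[q-1] σ) ^ (relRittOrder p q f g).toReal : ℝ) : EReal)) atTop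

/-- The (p,q)-th relative Ritt lower type of `f` with respect to `g`. -/
def relRittLowerType (p q : ℕ) (f : VVDS E) (g : VVDS F) : EReal :=
  liminf (fun σ : ℝ =>
    ((Real.log^[p-1] (g.Minv (f.M σ)) /
      (Real.log^[q-1] σ) ^ (relRittOrder p q f g).toReal : ℝ) : EReal)) atTop

/-- The (p,q)-th relative Ritt weak type of `f` with respect to `g`. -/
def relRittWeakType (p q : ℕ) (f : VVDS E) (g : VVDS F) : EReal :=
  liminf (fun σ : ℝ =>
    ((Real.log^[p-1] (g.Minv (f.M σ)) /
      (Real.log^[q-1] σ) ^ (relRittLowerOrder p q f g).toReal : ℝ) : EReal)) atTop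

/-- The growth indicator `τ̄_g^{(p,q)}(f)`. -/
def relRittUpperWeakType (p q : ℕ) (f : VVDS E) (g : VVDS F) : EReal :=
  limsup (fun σ : ℝ =>
    ((Real.log^[p-1] (g.Minv (f.M σ)) /
      (Real.log^[q-1] σ) ^ (relRittLowerOrder p q f g).toReal : ℝ) : EReal)) atTop

theorem VVDS.norm_term (f : VVDS E) (s : ℂ) (n : ℕ) :
    ‖Complex.exp (s * (f.lam n : ℂ)) • f.a n‖ = Real.exp (s.re * f.lam n) * ‖f.a n‖ := by
  rw [norm_smul, Complex.norm_exp]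
  simp

/-- The dominating sum. -/
def VVDS.S (f : VVDS E) (σ : ℝ) : ℝ := ∑' n, Real.exp (σ * f.lam n) * ‖f.a n‖

theorem VVDS.summable_S (f : VVDS E) (σ : ℝ) :
    Summable (fun n => Real.exp (σ * f.lam n) * ‖f.a n‖) := by
  simpa using f.abs_conv (σ : ℂ)

theorem VVDS.norm_le_S (f : VVDS E) (s : ℂ) : ‖f.toFun s‖ ≤ f.S s.re := by
  unfold VVDS.toFun VVDS.S
  refine tsum_of_norm_bounded (f.summable_S s.re).hasSum fun n => (f.norm_term s n).le

theorem VVDS.S_mono (f : VVDS E) : Monotone f.S := by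
  intro x y hxy
  refine (f.summable_S x).tsum_le_tsum (fun n => ?_) (f.summable_S y)
  have := f.lam_pos n
  gcongr

theorem VVDS.norm_le_M (f : VVDS E) (s : ℂ) : ‖f.toFun s‖ ≤ f.M s.re := by
  have h : BddAbove (Set.range fun t : ℝ => ‖f.toFun ((s.re : ℂ) + (t : ℂ) * Complex.I)‖) := by
    refine ⟨f.S s.re, ?_⟩
    rintro _ ⟨t, rfl⟩
    simpa using f.norm_le_S ((s.re : ℂ) + (t : ℂ) * Complex.I)
  have := le_ciSup h s.im
  simpa [VVDS.M] using this

theorem VVDS.M_le (f : VVDS E) (σ c : ℝ) (hc : ∀ s : ℂ, s.re = σ → ‖f.toFun s‖ ≤ c) :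
    f.M σ ≤ c := by
  refine ciSup_le fun t => hc _ (by simp)

theorem VVDS.M_le_S (f : VVDS E) (σ : ℝ) : f.M σ ≤ f.S σ :=
  f.M_le σ _ fun s hs => hs ▸ f.norm_le_S s

theorem VVDS.M_nonneg (f : VVDS E) (σ : ℝ) : 0 ≤ f.M σ := by
  have := f.norm_le_M (σ : ℂ)
  exact (norm_nonneg _).trans (by simpa using this)

theorem VVDS.differentiable (f : VVDS E) : Differentiable ℂ f.toFun := by
  intro z
  have hU : IsOpen {w : ℂ | w.re < z.re + 1} := isOpen_lt Complex.continuous_re continuous_const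
  have h : DifferentiableOn ℂ f.toFun {w : ℂ | w.re < z.re + 1} := by
    refine Complex.differentiableOn_tsum_of_summable_norm (f.summable_S (z.re + 1)) ?_ hU ?_
    · intro i
      fun_prop
    · intro i w hw
      rw [f.norm_term]
      have := f.lam_pos i
      have hw' : w.re ≤ z.re + 1 := le_of_lt hw
      gcongr
  exact h.differentiableAt (hU.mem_nhds (by simp))

theorem VVDS.three_lines (f : VVDS E) {l u x : ℝ} (hl : l < x) (hu : x < u) :
    f.M x ≤ f.M l ^ (1 - (x - l) / (u - l)) * f.M u ^ ((x - l) / (u - l)) := by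
  refine f.M_le x _ fun s hs => ?_
  subst hs
  refine Complex.HadamardThreeLines.norm_le_interp_of_mem_verticalClosedStrip' (hl.trans hu)
    ⟨hl.le, hu.le⟩ f.differentiable.diffContOnCl ?_ ?_ ?_
  · refine ⟨f.S u, ?_⟩
    rintro _ ⟨z, hz, rfl⟩
    exact (f.norm_le_S z).trans (f.S_mono hz.2)
  · intro z hz
    have : z.re = l := hz
    exact this ▸ f.norm_le_M z
  · intro z hz
    have : z.re = u := hz
    exact this ▸ f.norm_le_M z

theorem VVDS.S_tendsto (f : VVDS E) : Tendsto f.S atBot (𝓝 0) := by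
  have h := tendsto_tsum_of_dominated_convergence (𝓕 := (atBot : Filter ℝ))
    (f := fun σ n => Real.exp (σ * f.lam n) * ‖f.a n‖) (g := fun _ => (0 : ℝ))
    (f.summable_S 0) ?_ ?_
  · rw [tsum_zero] at h
    exact h
  · intro n
    have h1 : Tendsto (fun σ : ℝ => σ * f.lam n) atBot atBot :=
      tendsto_id.atBot_mul_const (f.lam_pos n)
    simpa using (Real.tendsto_exp_atBot.comp h1).mul_const ‖f.a n‖
  · filter_upwards [eventually_le_atBot 0] with σ hσ n
    have := f.lam_pos n
    rw [Real.norm_of_nonneg (by positivity)]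
    gcongr

theorem VVDS.M_tendsto_atBot (f : VVDS E) : Tendsto f.M atBot (𝓝 0) :=
  squeeze_zero f.M_nonneg f.M_le_S f.S_tendsto

theorem VVDS.exists_ne (f : VVDS E) : ∃ n, f.a n ≠ 0 := by
  by_contra! h
  have h1 := f.coeff_decay
  simp only [h, norm_zero, Real.log_zero, zero_div] at h1
  have := (h1.eventually (eventually_lt_atBot (0 : ℝ))).exists
  simp at this

theorem VVDS.eventually_ne (f : VVDS E) : ∀ᶠ σ : ℝ in atBot, f.toFun (σ : ℂ) ≠ 0 := by
  classical
  set k := Nat.find f.exists_ne with hk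
  have hk0 : f.a k ≠ 0 := Nat.find_spec f.exists_ne
  have hlt : ∀ n < k, f.a n = 0 := fun n hn => by
    have := Nat.find_min f.exists_ne hn
    simpa using this
  have h := tendsto_tsum_of_dominated_convergence (𝓕 := (atBot : Filter ℝ))
    (f := fun σ n => Real.exp (σ * (f.lam n - f.lam k)) • f.a n)
    (g := fun n => if n = k then f.a n else 0)
    (f.summable_S 0) ?_ ?_
  · rw [tsum_ite_eq] at h
    filter_upwards [h.eventually_ne hk0] with σ hσ h0
    apply hσ
    have : ∀ n, Real.exp (σ * (f.lam n - f.lam k)) • f.a n =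
        Complex.exp (-(σ * f.lam k : ℂ)) • (Complex.exp ((σ : ℂ) * (f.lam n : ℂ)) • f.a n) := by
      intro n
      rw [smul_smul, ← Complex.exp_add, ← Complex.coe_smul]
      push_cast
      congr 2
      ring
    simp_rw [this]
    rw [tsum_const_smul'']
    unfold VVDS.toFun at h0
    rw [h0, smul_zero]
  · intro n
    rcases lt_trichotomy n k with hn | hn | hn
    · simp [hlt n hn]
    · simp [hn]
    · have h0 : 0 < f.lam n - f.lam k := sub_pos.2 (f.lam_strictMono hn)
      have h1 : Tendsto (fun σ : ℝ => σ * (f.lam n - f.lam k)) atBot atBot :=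
        tendsto_id.atBot_mul_const h0
      simpa [hn.ne'] using (Real.tendsto_exp_atBot.comp h1).smul_const (f.a n)
  · filter_upwards [eventually_le_atBot 0] with σ hσ n
    rw [norm_smul, Real.norm_of_nonneg (by positivity)]
    rcases lt_or_ge n k with hn | hn
    · simp [hlt n hn]
    · have h0 : 0 ≤ f.lam n - f.lam k := sub_nonneg.2 (f.lam_strictMono.monotone hn)
      refine mul_le_mul_of_nonneg_right (Real.exp_le_exp.2 ?_) (norm_nonneg _)
      nlinarith

theorem VVDS.M_pos (f : VVDS E) (σ : ℝ) : 0 < f.M σ := by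
  refine (f.M_nonneg σ).lt_of_ne' fun h0 => ?_
  obtain ⟨x, hx, hne⟩ := ((eventually_lt_atBot σ).and f.eventually_ne).exists
  have h := f.three_lines (sub_one_lt x) hx
  have h1 : (x - (x - 1)) / (σ - (x - 1)) ≠ 0 := by
    have : 0 < σ - (x - 1) := by linarith
    have h2 : x - (x - 1) = 1 := by ring
    rw [h2]; positivity
  rw [h0, Real.zero_rpow h1, mul_zero] at h
  have h3 := (f.norm_le_M (x : ℂ)).trans (by simpa using h)
  exact hne (norm_le_zero_iff.1 h3)

theorem VVDS.logM_convex (f : VVDS E) : ConvexOn ℝ Set.univ (fun σ => Real.log (f.M σ)) := by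
  refine LinearOrder.convexOn_of_lt convex_univ fun x _ y _ hxy a b ha hb hab => ?_
  have hb' : a = 1 - b := by linarith
  subst hb'
  have hl : x < (1 - b) • x + b • y := by simp only [smul_eq_mul]; nlinarith
  have hu : (1 - b) • x + b • y < y := by simp only [smul_eq_mul]; nlinarith
  have h := f.three_lines hl hu
  have e : ((1 - b) • x + b • y - x) / (y - x) = b := by
    have : y - x ≠ 0 := by linarith
    simp only [smul_eq_mul]
    field_simp
    ring
  rw [e] at h
  have := Real.log_le_log (f.M_pos _) h
  rwa [Real.log_mul (Real.rpow_pos_of_pos (f.M_pos _) _).ne'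
    (Real.rpow_pos_of_pos (f.M_pos _) _).ne', Real.log_rpow (f.M_pos _),
    Real.log_rpow (f.M_pos _)] at this

theorem VVDS.M_strictMono (f : VVDS E) : StrictMono f.M := by
  intro s t hst
  obtain ⟨r, hr, hrs⟩ := ((eventually_lt_atBot s).and
    (f.M_tendsto_atBot.eventually (eventually_lt_nhds (f.M_pos s)))).exists
  have h := f.logM_convex.lt_right_of_left_lt (Set.mem_univ r) (Set.mem_univ t)
    (z := s) (by rw [openSegment_eq_Ioo (hr.trans hst)]; exact ⟨hr, hst⟩)
    (Real.log_lt_log (f.M_pos _) hrs)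
  exact (Real.log_lt_log_iff (f.M_pos _) (f.M_pos _)).1 h

theorem VVDS.M_continuous (f : VVDS E) : Continuous f.M := by
  have h : Continuous (fun σ => Real.log (f.M σ)) := by
    rw [← continuousOn_univ]
    exact f.logM_convex.continuousOn isOpen_univ
  have h2 := Real.continuous_exp.comp h
  have e : f.M = Real.exp ∘ fun σ => Real.log (f.M σ) := by
    funext σ
    simp [Real.exp_log (f.M_pos σ)]
  rw [e]
  exact h2

theorem VVDS.M_tendsto_atTop (f : VVDS E) : Tendsto f.M atTop atTop := by
  have h0 : 0 < Real.log (f.M 1) - Real.log (f.M 0) :=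
    sub_pos.2 (Real.log_lt_log (f.M_pos _) (f.M_strictMono zero_lt_one))
  have h1 : Tendsto (fun σ => Real.log (f.M σ)) atTop atTop := by
    have h2 : Tendsto (fun σ : ℝ => Real.log (f.M 0) +
        σ * (Real.log (f.M 1) - Real.log (f.M 0))) atTop atTop :=
      tendsto_atTop_add_const_left _ _ (tendsto_id.atTop_mul_const h0)
    refine tendsto_atTop_mono' _ ?_ h2
    filter_upwards [eventually_gt_atTop 1] with σ hσ
    have hpos : 0 < σ := by linarith
    have h3 := f.logM_convex.2 (Set.mem_univ 0) (Set.mem_univ σ)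
      (show 0 ≤ 1 - 1 / σ by rw [sub_nonneg, div_le_one hpos]; exact hσ.le)
      (show 0 ≤ 1 / σ by positivity) (by ring)
    simp only [smul_eq_mul, mul_zero, zero_add, one_div, inv_mul_cancel₀ hpos.ne'] at h3
    have h4 := mul_le_mul_of_nonneg_left h3 hpos.le
    have h5 : σ * ((1 - σ⁻¹) * Real.log (f.M 0) + σ⁻¹ * Real.log (f.M σ)) =
        (σ - 1) * Real.log (f.M 0) + Real.log (f.M σ) := by
      field_simp
    rw [h5] at h4
    linarith
  have h2 := Real.tendsto_exp_atTop.comp h1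
  refine h2.congr fun σ => ?_
  simp [Real.exp_log (f.M_pos σ)]

theorem VVDS.Minv_M (f : VVDS E) (σ : ℝ) : f.Minv (f.M σ) = σ := by
  have : {x : ℝ | f.M σ ≤ f.M x} = Set.Ici σ := by
    ext x
    simp [f.M_strictMono.le_iff_le]
  rw [VVDS.Minv, this, csInf_Ici]

theorem VVDS.exists_M_eq (f : VVDS E) {y : ℝ} (hy : 0 < y) : ∃ σ, f.M σ = y := by
  obtain ⟨r, hr⟩ := (f.M_tendsto_atBot.eventually (eventually_lt_nhds hy)).exists
  obtain ⟨t, ht⟩ := (f.M_tendsto_atTop.eventually (eventually_ge_atTop y)).exists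
  exact mem_range_of_exists_le_of_exists_ge f.M_continuous ⟨r, hr.le⟩ ⟨t, ht⟩

theorem VVDS.M_Minv (f : VVDS E) {y : ℝ} (hy : 0 < y) : f.M (f.Minv y) = y := by
  obtain ⟨σ, rfl⟩ := f.exists_M_eq hy
  rw [f.Minv_M]

theorem VVDS.Minv_tendsto (g : VVDS F) (f : VVDS E) :
    Tendsto (fun σ => g.Minv (f.M σ)) atTop atTop := by
  refine tendsto_atTop.2 fun R => ?_
  filter_upwards [f.M_tendsto_atTop.eventually (eventually_ge_atTop (g.M R))] with σ hσ
  rw [← g.M_strictMono.le_iff_le, g.M_Minv (f.M_pos σ)]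
  exact hσ

theorem iterlog_tendsto (k : ℕ) : Tendsto (Real.log^[k]) atTop atTop := by
  induction k with
  | zero => exact tendsto_id
  | succ k ih => rw [Function.iterate_succ']; exact Real.tendsto_log_atTop.comp ih

/-- Abstract comparison: frequently in `σ` we have both estimates. -/
theorem core_le {X Y V : ℝ → ℝ} {A β μ K : ℝ} (hβ : 0 < β) (hμ : μ ≤ A / β)
    (hX : Tendsto X atTop atTop) (hY : Tendsto Y atTop atTop) (hK : 0 ≤ K)
    (H : ∀ c : ℝ, 0 < c → c < K → ∃ D : ℝ, 0 < D ∧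
      ∃ᶠ σ in atTop, c * D < V σ / Y σ ^ A ∧ V σ / X σ ^ β < D) :
    ((K ^ (1 / β) : ℝ) : EReal) ≤
      limsup (fun σ => ((X σ / Y σ ^ μ : ℝ) : EReal)) atTop := by
  have pos : (0 : EReal) ≤ limsup (fun σ => ((X σ / Y σ ^ μ : ℝ) : EReal)) atTop := by
    refine le_limsup_of_frequently_le' (Eventually.frequently ?_)
    filter_upwards [hX.eventually_gt_atTop 0, hY.eventually_gt_atTop 0] with σ h1 h2
    have : 0 ≤ X σ / Y σ ^ μ := by positivity
    exact_mod_cast this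
  refine EReal.ge_of_forall_gt_iff_ge.1 fun z hz => ?_
  rcases le_or_gt z 0 with hz0 | hz0
  · exact le_trans (by exact_mod_cast hz0) pos
  have hz' : z < K ^ (1 / β) := by exact_mod_cast hz
  have hzK : z ^ β < K := by
    have := Real.rpow_lt_rpow hz0.le hz' hβ
    rwa [← Real.rpow_mul hK, one_div, inv_mul_cancel₀ hβ.ne', Real.rpow_one] at this
  obtain ⟨D, hD, hfr⟩ := H (z ^ β) (by positivity) hzK
  refine le_limsup_of_frequently_le' ?_
  refine (hfr.and_eventually
    ((hX.eventually_gt_atTop 0).and (hY.eventually_gt_atTop 1))).mono ?_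
  rintro σ ⟨⟨h1, h2⟩, hx, hy⟩
  have hy0 : 0 < Y σ := by linarith
  rw [lt_div_iff₀ (by positivity)] at h1
  rw [div_lt_iff₀ (by positivity)] at h2
  have h3 : z ^ β * Y σ ^ A < X σ ^ β := by
    have : D * (z ^ β * Y σ ^ A) < D * X σ ^ β := by nlinarith
    exact lt_of_mul_lt_mul_left this hD.le
  have h4 : (z * Y σ ^ (A / β)) ^ β < X σ ^ β := by
    rwa [Real.mul_rpow hz0.le (by positivity), ← Real.rpow_mul hy0.le, div_mul_cancel₀ _ hβ.ne']
  have h5 : z * Y σ ^ (A / β) < X σ :=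
    (Real.rpow_lt_rpow_iff (by positivity) hx.le hβ).1 h4
  have h6 : z * Y σ ^ μ ≤ z * Y σ ^ (A / β) :=
    mul_le_mul_of_nonneg_left (Real.rpow_le_rpow_of_exponent_le hy.le hμ) hz0.le
  have : z ≤ X σ / Y σ ^ μ := by
    rw [le_div_iff₀ (by positivity)]
    linarith
  exact_mod_cast this

theorem coe_toReal_pos {a : EReal} (h0 : 0 < a) (h1 : a < ⊤) :
    ((a.toReal : ℝ) : EReal) = a ∧ 0 < a.toReal :=
  ⟨EReal.coe_toReal h1.ne (h0.trans' EReal.bot_lt_zero).ne', EReal.toReal_pos h0 h1.ne⟩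

/-- limsup / limsup version -/
theorem core_sup {X Y V ξ U W : ℝ → ℝ} {A β μ : ℝ} (hβ : 0 < β) (hμ : μ ≤ A / β)
    (hξ : Tendsto ξ atTop atTop) (hV : ∀ σ, V σ = U (ξ σ)) (hXW : ∀ σ, X σ = W (ξ σ))
    (hX : Tendsto X atTop atTop) (hY : Tendsto Y atTop atTop) {D1 D2 : EReal}
    (e1 : D1 = limsup (fun σ => ((V σ / Y σ ^ A : ℝ) : EReal)) atTop)
    (e2 : D2 = limsup (fun r => ((U r / W r ^ β : ℝ) : EReal)) atTop)
    (h1 : 0 < D1) (h1' : D1 < ⊤) (h2 : 0 < D2) (h2' : D2 < ⊤) :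
    (((D1.toReal / D2.toReal) ^ (1 / β) : ℝ) : EReal) ≤
      limsup (fun σ => ((X σ / Y σ ^ μ : ℝ) : EReal)) atTop := by
  obtain ⟨c1, p1⟩ := coe_toReal_pos h1 h1'
  obtain ⟨c2, p2⟩ := coe_toReal_pos h2 h2'
  refine core_le (V := V) hβ hμ hX hY (by positivity) fun c hc hcK => ?_
  rw [lt_div_iff₀ p2] at hcK
  obtain ⟨D, hD, hD'⟩ := exists_between ((lt_div_iff₀' hc).2 hcK)
  rw [lt_div_iff₀' hc] at hD'
  refine ⟨D, p2.trans hD, ?_⟩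
  have f1 : ∃ᶠ σ in atTop, ((c * D : ℝ) : EReal) < ((V σ / Y σ ^ A : ℝ) : EReal) := by
    refine frequently_lt_of_lt_limsup (by isBoundedDefault) ?_
    rw [← e1, ← c1]
    exact_mod_cast hD'
  have f2 : ∀ᶠ r in atTop, ((U r / W r ^ β : ℝ) : EReal) < (D : EReal) := by
    refine eventually_lt_of_limsup_lt ?_
    rw [← e2, ← c2]
    exact_mod_cast hD
  refine (f1.and_eventually (hξ.eventually f2)).mono ?_
  rintro σ ⟨g1, g2⟩
  refine ⟨by exact_mod_cast g1, ?_⟩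
  rw [hV, hXW]
  exact_mod_cast g2

/-- liminf / liminf version -/
theorem core_inf {X Y V ξ U W s : ℝ → ℝ} {A β μ : ℝ} (hβ : 0 < β) (hμ : μ ≤ A / β)
    (hs : Tendsto s atTop atTop) (hsξ : ∀ r, ξ (s r) = r)
    (hV : ∀ σ, V σ = U (ξ σ)) (hXW : ∀ σ, X σ = W (ξ σ))
    (hX : Tendsto X atTop atTop) (hY : Tendsto Y atTop atTop) {D1 D2 : EReal}
    (e1 : D1 = liminf (fun σ => ((V σ / Y σ ^ A : ℝ) : EReal)) atTop)
    (e2 : D2 = liminf (fun r => ((U r / W r ^ β : ℝ) : EReal)) atTop)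
    (h1 : 0 < D1) (h1' : D1 < ⊤) (h2 : 0 < D2) (h2' : D2 < ⊤) :
    (((D1.toReal / D2.toReal) ^ (1 / β) : ℝ) : EReal) ≤
      limsup (fun σ => ((X σ / Y σ ^ μ : ℝ) : EReal)) atTop := by
  obtain ⟨c1, p1⟩ := coe_toReal_pos h1 h1'
  obtain ⟨c2, p2⟩ := coe_toReal_pos h2 h2'
  refine core_le (V := V) hβ hμ hX hY (by positivity) fun c hc hcK => ?_
  rw [lt_div_iff₀ p2] at hcK
  obtain ⟨D, hD, hD'⟩ := exists_between ((lt_div_iff₀' hc).2 hcK)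
  rw [lt_div_iff₀' hc] at hD'
  refine ⟨D, p2.trans hD, ?_⟩
  have f1 : ∀ᶠ σ in atTop, ((c * D : ℝ) : EReal) < ((V σ / Y σ ^ A : ℝ) : EReal) := by
    refine eventually_lt_of_lt_liminf ?_
    rw [← e1, ← c1]
    exact_mod_cast hD'
  have f2 : ∃ᶠ r in atTop, ((U r / W r ^ β : ℝ) : EReal) < (D : EReal) := by
    refine frequently_lt_of_liminf_lt (by isBoundedDefault) ?_
    rw [← e2, ← c2]
    exact_mod_cast hD
  refine hs.frequently ((f2.and_eventually (hs.eventually f1)).mono ?_)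
  rintro r ⟨g2, g1⟩
  refine ⟨by exact_mod_cast g1, ?_⟩
  rw [hV, hXW, hsξ]
  exact_mod_cast g2

/-- The relative lower order is at most the quotient of the orders. -/
theorem order_le {X Y V ξ U W s : ℝ → ℝ}
    (hs : Tendsto s atTop atTop) (hsξ : ∀ r, ξ (s r) = r)
    (hV : ∀ σ, V σ = U (ξ σ)) (hXW : ∀ σ, X σ = W (ξ σ))
    (hX : Tendsto X atTop atTop) (hY : Tendsto Y atTop atTop) {A B : EReal}
    (e1 : A = limsup (fun σ => ((V σ / Y σ : ℝ) : EReal)) atTop)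
    (e2 : B = limsup (fun r => ((U r / W r : ℝ) : EReal)) atTop)
    (h1 : 0 < A) (h1' : A < ⊤) (h2 : 0 < B) (h2' : B < ⊤) :
    liminf (fun σ => ((X σ / Y σ : ℝ) : EReal)) atTop ≤ ((A.toReal / B.toReal : ℝ) : EReal) := by
  obtain ⟨c1, p1⟩ := coe_toReal_pos h1 h1'
  obtain ⟨c2, p2⟩ := coe_toReal_pos h2 h2'
  refine EReal.le_of_forall_lt_iff_le.1 fun c hc => ?_
  have hc' : A.toReal / B.toReal < c := by exact_mod_cast hc
  have hc0 : 0 < c := lt_trans (by positivity) hc'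
  rw [div_lt_iff₀ p2] at hc'
  obtain ⟨D, hD, hD'⟩ := exists_between ((div_lt_iff₀' hc0).2 hc')
  have hD0 : 0 < D := lt_trans (by positivity) hD
  rw [div_lt_iff₀' hc0] at hD
  have f1 : ∀ᶠ σ in atTop, ((V σ / Y σ : ℝ) : EReal) < ((c * D : ℝ) : EReal) := by
    refine eventually_lt_of_limsup_lt ?_
    rw [← e1, ← c1]
    exact_mod_cast hD
  have f2 : ∃ᶠ r in atTop, (D : EReal) < ((U r / W r : ℝ) : EReal) := by
    refine frequently_lt_of_lt_limsup (by isBoundedDefault) ?_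
    rw [← e2, ← c2]
    exact_mod_cast hD'
  refine liminf_le_of_frequently_le' (hs.frequently ((f2.and_eventually (hs.eventually
    (f1.and ((hX.eventually_gt_atTop 0).and (hY.eventually_gt_atTop 0))))).mono ?_))
  rintro r ⟨g2, g1, gx, gy⟩
  have g1' : V (s r) / Y (s r) < c * D := by exact_mod_cast g1
  have g2' : D < V (s r) / X (s r) := by
    rw [hV, hXW, hsξ]
    exact_mod_cast g2
  rw [div_lt_iff₀ gy] at g1'
  rw [lt_div_iff₀ gx] at g2'
  have : X (s r) / Y (s r) ≤ c := by
    rw [div_le_iff₀ gy]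
    refine le_of_mul_le_mul_left (a := D) ?_ hD0
    linarith
  exact_mod_cast this

theorem stmt_17 (f : VVDS E) (g : VVDS F) (h : VVDS G) (p q m : ℕ)
    (hf1 : (0 : EReal) < relRittLowerOrder m q f h)
    (hf2 : relRittLowerOrder m q f h ≤ relRittOrder m q f h)
    (hf3 : relRittOrder m q f h < ⊤)
    (hg1 : (0 : EReal) < relRittLowerOrder m p g h)
    (hg2 : relRittLowerOrder m p g h ≤ relRittOrder m p g h)
    (hg3 : relRittOrder m p g h < ⊤)
    (hDf1 : (0 : EReal) < relRittType m q f h)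
    (hDf2 : relRittType m q f h < ⊤)
    (hDbf1 : (0 : EReal) < relRittLowerType m q f h)
    (hDbf2 : relRittLowerType m q f h < ⊤)
    (hDg1 : (0 : EReal) < relRittType m p g h)
    (hDg2 : relRittType m p g h < ⊤)
    (hDbg1 : (0 : EReal) < relRittLowerType m p g h)
    (hDbg2 : relRittLowerType m p g h < ⊤)
    (htg1 : (0 : EReal) < relRittWeakType m p g h)
    (htg2 : relRittWeakType m p g h < ⊤)
    (htbg1 : (0 : EReal) < relRittUpperWeakType m p g h)
    (htbg2 : relRittUpperWeakType m p g h < ⊤)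
    :
    ((max (max (((relRittLowerType m q f h).toReal / (relRittLowerType m p g h).toReal) ^ (1 / (relRittOrder m p g h).toReal)) (((relRittType m q f h).toReal / (relRittType m p g h).toReal) ^ (1 / (relRittOrder m p g h).toReal))) (max (((relRittType m q f h).toReal / (relRittUpperWeakType m p g h).toReal) ^ (1 / (relRittLowerOrder m p g h).toReal)) (((relRittLowerType m q f h).toReal / (relRittWeakType m p g h).toReal) ^ (1 / (relRittLowerOrder m p g h).toReal))) : ℝ) : EReal) ≤ relRittUpperWeakType p q f g := by
  have hA0 : 0 < relRittOrder m q f h := hf1.trans_le hf2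
  have hB0 : 0 < relRittOrder m p g h := hg1.trans_le hg2
  have hb' : relRittLowerOrder m p g h < ⊤ := hg2.trans_lt hg3
  obtain ⟨cA, pA⟩ := coe_toReal_pos hA0 hf3
  obtain ⟨cB, pB⟩ := coe_toReal_pos hB0 hg3
  obtain ⟨cb, pb⟩ := coe_toReal_pos hg1 hb'
  have hbB : (relRittLowerOrder m p g h).toReal ≤ (relRittOrder m p g h).toReal :=
    EReal.toReal_le_toReal hg2 (hg1.trans' EReal.bot_lt_zero).ne' hg3.ne
  have hξ : Tendsto (fun σ => g.Minv (f.M σ)) atTop atTop := g.Minv_tendsto f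
  have hs : Tendsto (fun r => f.Minv (g.M r)) atTop atTop := f.Minv_tendsto g
  have hsξ : ∀ r, g.Minv (f.M (f.Minv (g.M r))) = r := fun r => by
    rw [f.M_Minv (g.M_pos r), g.Minv_M]
  have hM : ∀ σ, g.M (g.Minv (f.M σ)) = f.M σ := fun σ => g.M_Minv (f.M_pos σ)
  have hV : ∀ (k : ℕ) σ, Real.log^[k] (h.Minv (f.M σ)) =
      (fun r => Real.log^[k] (h.Minv (g.M r))) (g.Minv (f.M σ)) := fun k σ => by
    simp only [hM]
  have hX : ∀ k : ℕ, Tendsto (fun σ => Real.log^[k] (g.Minv (f.M σ))) atTop atTop :=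
    fun k => (iterlog_tendsto k).comp hξ
  have hμ : relRittLowerOrder p q f g ≤
      (((relRittOrder m q f h).toReal / (relRittOrder m p g h).toReal : ℝ) : EReal) :=
    order_le (ξ := fun σ => g.Minv (f.M σ)) hs hsξ (hV m) (fun _ => rfl) (hX p)
      (iterlog_tendsto q) rfl rfl hA0 hf3 hB0 hg3
  have hμB : (relRittLowerOrder p q f g).toReal ≤
      (relRittOrder m q f h).toReal / (relRittOrder m p g h).toReal := by
    rcases eq_or_ne (relRittLowerOrder p q f g) ⊥ with hbot | hbot
    · rw [hbot, EReal.toReal_bot]; positivity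
    · have := EReal.toReal_le_toReal hμ hbot (EReal.coe_ne_top _)
      rwa [EReal.toReal_coe] at this
  have hμb : (relRittLowerOrder p q f g).toReal ≤
      (relRittOrder m q f h).toReal / (relRittLowerOrder m p g h).toReal :=
    hμB.trans (div_le_div_of_nonneg_left pA.le pb hbB)
  have K1 := core_inf (ξ := fun σ => g.Minv (f.M σ)) pB hμB hs hsξ (hV (m-1)) (fun _ => rfl)
    (hX (p-1)) (iterlog_tendsto (q-1)) (D1 := relRittLowerType m q f h)
    (D2 := relRittLowerType m p g h) rfl rfl hDbf1 hDbf2 hDbg1 hDbg2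
  have K2 := core_sup (ξ := fun σ => g.Minv (f.M σ)) pB hμB hξ (hV (m-1)) (fun _ => rfl)
    (hX (p-1)) (iterlog_tendsto (q-1)) (D1 := relRittType m q f h)
    (D2 := relRittType m p g h) rfl rfl hDf1 hDf2 hDg1 hDg2
  have K3 := core_sup (ξ := fun σ => g.Minv (f.M σ)) pb hμb hξ (hV (m-1)) (fun _ => rfl)
    (hX (p-1)) (iterlog_tendsto (q-1)) (D1 := relRittType m q f h)
    (D2 := relRittUpperWeakType m p g h) rfl rfl hDf1 hDf2 htbg1 htbg2
  have K4 := core_inf (ξ := fun σ => g.Minv (f.M σ)) pb hμb hs hsξ (hV (m-1)) (fun _ => rfl)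
    (hX (p-1)) (iterlog_tendsto (q-1)) (D1 := relRittLowerType m q f h)
    (D2 := relRittWeakType m p g h) rfl rfl hDbf1 hDbf2 htg1 htg2
  have hmax : ∀ a b : ℝ, ∀ c : EReal, (a : EReal) ≤ c → (b : EReal) ≤ c →
      ((max a b : ℝ) : EReal) ≤ c := fun a b c ha hb => by
    rcases max_choice a b with e | e <;> rw [e] <;> assumption
  exact hmax _ _ _ (hmax _ _ _ K1 K2) (hmax _ _ _ K3 K4)
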